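/- Let p be an odd prime, let H be the extraspecial p-group of order p³ and exponent p, and let G = H × C, where C is an elementary abelian p-group of rank n ≥ 1. Then the Schur multiplier M(G) = H²(G, ℂ*) is an elementary abelian p-group of order p^(n(n+3)/2 + 2). -/

import Mathlib

/-!
Setting (central products): `G` is a group with normal subgroups `H` and `K` such that
`G = HK` (i.e. `H ⊔ K = ⊤`) and `[H, K] = 1` (i.e. every element of `H` commutes with
every element of `K`).  We set `A = H ⊓ K` and `Z = ⁅H,H⁆ ⊓ ⁅K,K⁆`; both are central
in `G`.  Coefficients are taken in a divisible abelian group `D`, regarded as a trivial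
module.  Second cohomology `H2 X D` is realized concretely as (inhomogeneous)
2-cocycles modulo 2-coboundaries, and `Hom(X, D)` is realized as `Additive X →+ D`.
-/

open scoped TensorProduct

set_option maxHeartbeats 1000000
set_option synthInstance.maxHeartbeats 1000000
set_option synthInstance.maxSize 2000

namespace SchurCP

variable (G : Type) [Group G] (D : Type) [AddCommGroup D]

/-- The group of 2-cocycles on `G` with values in the trivial module `D`. -/
def cocycles2 : AddSubgroup (G → G → D) where
  carrier := {f | ∀ g h k : G, f g h + f (g * h) k = f h k + f g (h * k)}
  zero_mem' := by intro g h k; simp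
  add_mem' := by
    intro a b ha hb g h k
    simp only [Pi.add_apply]
    rw [add_add_add_comm, ha g h k, hb g h k, add_add_add_comm]
  neg_mem' := by
    intro a ha g h k
    simp only [Pi.neg_apply]
    rw [← neg_add, ← neg_add, ha g h k]

/-- The group of 2-coboundaries on `G` with values in the trivial module `D`. -/
def coboundaries2 : AddSubgroup (G → G → D) where
  carrier := {f | ∃ φ : G → D, ∀ g h : G, f g h = φ g + φ h - φ (g * h)}
  zero_mem' := ⟨0, by simp⟩
  add_mem' := by
    rintro a b ⟨φ, hφ⟩ ⟨ψ, hψ⟩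
    exact ⟨φ + ψ, fun g h => by simp only [Pi.add_apply, hφ g h, hψ g h]; abel⟩
  neg_mem' := by
    rintro a ⟨φ, hφ⟩
    exact ⟨-φ, fun g h => by simp only [Pi.neg_apply, hφ g h]; abel⟩

/-- The second cohomology group `H²(G, D)` of `G` with coefficients in the
trivial module `D`. -/
def H2 : Type := cocycles2 G D ⧸ (coboundaries2 G D).addSubgroupOf (cocycles2 G D)

instance : AddCommGroup (H2 G D) :=
  QuotientAddGroup.Quotient.addCommGroup ((coboundaries2 G D).addSubgroupOf (cocycles2 G D))

variable {G D}

/-- The cohomology class of a 2-cocycle. -/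
abbrev H2mk (f : cocycles2 G D) : H2 G D := QuotientAddGroup.mk f

/-- Pullback of a 2-cocycle along a group homomorphism. -/
def pullCocycle {G' : Type} [Group G'] (π : G' →* G) :
    cocycles2 G D →+ cocycles2 G' D where
  toFun f := ⟨fun x y => (f : G → G → D) (π x) (π y), by
    intro x y z
    simpa only [map_mul] using f.2 (π x) (π y) (π z)⟩
  map_zero' := rfl
  map_add' _ _ := rfl

/-- The homomorphism `H²(G, D) → H²(G', D)` induced by a group homomorphism
`π : G' → G`; this specializes to restriction maps (for inclusions of subgroups)
and to inflation maps (for quotient maps). -/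
def H2Map {G' : Type} [Group G'] (π : G' →* G) : H2 G D →+ H2 G' D :=
  QuotientAddGroup.map _ _ (pullCocycle π) (by
    intro f hf
    rw [AddSubgroup.mem_addSubgroupOf] at hf
    rw [AddSubgroup.mem_comap, AddSubgroup.mem_addSubgroupOf]
    obtain ⟨φ, hφ⟩ := hf
    exact ⟨fun x => φ (π x), fun x y => by
      show (f : G → G → D) (π x) (π y) = _
      rw [hφ (π x) (π y), ← map_mul]⟩)

theorem commutator_le_self {X : Type} [Group X] (H : Subgroup X) : ⁅H, H⁆ ≤ H := by
  rw [Subgroup.commutator_le]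
  intro g₁ h₁ g₂ h₂
  rw [commutatorElement_def]
  exact H.mul_mem (H.mul_mem (H.mul_mem h₁ h₂) (H.inv_mem h₁)) (H.inv_mem h₂)

theorem inf_commutator_le_inf {X : Type} [Group X] (H K : Subgroup X) :
    ⁅H, H⁆ ⊓ ⁅K, K⁆ ≤ H ⊓ K :=
  inf_le_inf (commutator_le_self H) (commutator_le_self K)

theorem subgroupOf_le {X : Type} [Group X] {B C : Subgroup X} (h : B ≤ C)
    (J : Subgroup X) : B.subgroupOf J ≤ C.subgroupOf J := fun _x hx => h hx

/-- The natural projection `X/N → X/M` for `N ≤ M`. -/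
def quotProj {X : Type} [Group X] {N M : Subgroup X} [N.Normal] [M.Normal] (h : N ≤ M) :
    (X ⧸ N) →* (X ⧸ M) :=
  QuotientGroup.map N M (MonoidHom.id X) (by rwa [Subgroup.comap_id])

/-- The inflation homomorphism `H²(X/M, D) → H²(X/N, D)` for `N ≤ M`. -/
def inflMap {X : Type} [Group X] {N M : Subgroup X} [N.Normal] [M.Normal]
    (h : N ≤ M) (D : Type) [AddCommGroup D] : H2 (X ⧸ M) D →+ H2 (X ⧸ N) D :=
  H2Map (quotProj h)

/-- The natural homomorphism `H/(A ∩ H) → X/A` for subgroups `A, H` of `X`;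
for `A ≤ H` this realizes `H/A` as a subgroup of `X/A`. -/
def quotInclusion {X : Type} [Group X] (H A : Subgroup X) [A.Normal]
    [(A.subgroupOf H).Normal] : (↥H ⧸ A.subgroupOf H) →* X ⧸ A :=
  QuotientGroup.map (A.subgroupOf H) A H.subtype (fun _x hx => hx)

/-- The abelian tensor product `X ⊗ Y = X/[X,X] ⊗_ℤ Y/[Y,Y]` of two groups. -/
abbrev AbTensor (X Y : Type) [Group X] [Group Y] : Type :=
  TensorProduct ℤ (Additive (Abelianization X)) (Additive (Abelianization Y))

/-- The element `x[X,X] ⊗ y[Y,Y]` of the abelian tensor product. -/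
noncomputable abbrev tmulAb {X Y : Type} [Group X] [Group Y] (x : X) (y : Y) :
    AbTensor X Y :=
  Additive.ofMul (Abelianization.of x) ⊗ₜ[ℤ] Additive.ofMul (Abelianization.of y)

/-- The map on abelian tensor products induced by a pair of group homomorphisms. -/
noncomputable def abTensorMap {X Y X' Y' : Type} [Group X] [Group Y] [Group X'] [Group Y']
    (f : X →* X') (g : Y →* Y') : AbTensor X Y →ₗ[ℤ] AbTensor X' Y' :=
  TensorProduct.map (MonoidHom.toAdditive (Abelianization.map f)).toIntLinearMap
    (MonoidHom.toAdditive (Abelianization.map g)).toIntLinearMap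

/-! ### The commutator pairing -/

/-- For commuting `g, h`, the commutator `f(g, h) - f(h, g)` of lifts of `g` and `h` to the
central extension attached to `f` depends only on the cohomology class of `f`. -/
def commPairing {G : Type} [Group G] {D : Type} [AddCommGroup D] (g h : G)
    (hc : Commute g h) : H2 G D →+ D :=
  QuotientAddGroup.lift _
    { toFun := fun f : cocycles2 G D => f.1 g h - f.1 h g
      map_zero' := by simp
      map_add' := fun a b => by
        simp only [AddSubgroup.coe_add, Pi.add_apply]; abel }
    (by
      intro f hf
      obtain ⟨φ, hφ⟩ := AddSubgroup.mem_addSubgroupOf.mp hf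
      change f.1 g h - f.1 h g = 0
      rw [hφ g h, hφ h g, hc.eq]
      abel)

theorem commPairing_mk {G : Type} [Group G] {D : Type} [AddCommGroup D] {g h : G}
    (hc : Commute g h) (f : cocycles2 G D) :
    commPairing g h hc (H2mk f) = f.1 g h - f.1 h g := rfl

theorem cocycle_comm_mul {G : Type} [Group G] {D : Type} [AddCommGroup D]
    (f : cocycles2 G D) {g h k : G} (hh : Commute g h) (hk : Commute g k) :
    f.1 g (h * k) - f.1 (h * k) g = (f.1 g h - f.1 h g) + (f.1 g k - f.1 k g) := by
  have h1 := f.2 g h k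
  have h2 := f.2 h k g
  have h3 := f.2 h g k
  rw [← hh.eq] at h3
  rw [← hk.eq] at h2
  have e1 : f.1 g (h * k) = f.1 g h + f.1 (g * h) k - f.1 h k := by rw [h1]; abel
  have e2 : f.1 (h * k) g = f.1 k g + f.1 h (g * k) - f.1 h k := by rw [← h2]; abel
  have e3 : f.1 (g * h) k = f.1 g k + f.1 h (g * k) - f.1 h g := by rw [← h3]; abel
  rw [e1, e2, e3]
  abel

theorem cocycle_comm_pow {G : Type} [Group G] {D : Type} [AddCommGroup D]
    (f : cocycles2 G D) {g h : G} (hh : Commute g h) (m : ℕ) :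
    f.1 g (h ^ m) - f.1 (h ^ m) g = m • (f.1 g h - f.1 h g) := by
  induction m with
  | zero =>
    have := cocycle_comm_mul f (Commute.one_right g) (Commute.one_right g)
    simpa using this
  | succ m ih =>
    rw [pow_succ, cocycle_comm_mul f (hh.pow_right m) hh, ih, succ_nsmul]

theorem nsmul_commPairing {G : Type} [Group G] {D : Type} [AddCommGroup D] {g h : G}
    (hc : Commute g h) {m : ℕ} (hm : h ^ m = 1) (x : H2 G D) :
    m • commPairing g h hc x = 0 := by
  obtain ⟨f, rfl⟩ := QuotientAddGroup.mk_surjective x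
  change m • (f.1 g h - f.1 h g) = 0
  rw [← cocycle_comm_pow f hc, hm]
  simpa using cocycle_comm_pow f (Commute.one_right g) 0

/-! ### The central extension attached to a cocycle -/

/-- The central extension of `G` by `D` attached to the cocycle `f`. -/
@[ext]
structure CocycleExt {G : Type} [Group G] {D : Type} [AddCommGroup D]
    (f : cocycles2 G D) where
  /-- The coordinate in the kernel. -/
  fib : D
  /-- The projection to the base group. -/
  base : G

namespace CocycleExt

variable {G : Type} [Group G] {D : Type} [AddCommGroup D] {f : cocycles2 G D}

instance : Mul (CocycleExt f) := ⟨fun u v => ⟨u.fib + v.fib + f.1 u.base v.base, u.base * v.base⟩⟩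

instance : One (CocycleExt f) := ⟨⟨-f.1 1 1, 1⟩⟩

instance : Inv (CocycleExt f) :=
  ⟨fun u => ⟨-u.fib - f.1 u.base⁻¹ u.base - f.1 1 1, u.base⁻¹⟩⟩

theorem mul_fib (u v : CocycleExt f) : (u * v).fib = u.fib + v.fib + f.1 u.base v.base := rfl

theorem mul_base (u v : CocycleExt f) : (u * v).base = u.base * v.base := rfl

theorem one_fib : (1 : CocycleExt f).fib = -f.1 1 1 := rfl

theorem one_base : (1 : CocycleExt f).base = 1 := rfl

theorem inv_fib (u : CocycleExt f) :
    (u⁻¹).fib = -u.fib - f.1 u.base⁻¹ u.base - f.1 1 1 := rfl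

theorem inv_base (u : CocycleExt f) : (u⁻¹).base = u.base⁻¹ := rfl

theorem cocycle_one_left (g : G) : f.1 1 g = f.1 1 1 := by
  have := f.2 1 1 g
  simp only [one_mul] at this
  exact (add_right_cancel this).symm

theorem cocycle_one_right (g : G) : f.1 g 1 = f.1 1 1 := by
  have := f.2 g 1 1
  simp only [mul_one] at this
  exact add_right_cancel this

instance : Group (CocycleExt f) :=
  Group.ofLeftAxioms
    (by
      intro u v w
      ext
      · simp only [mul_fib, mul_base]
        have e : f.1 (u.base * v.base) w.base
            = f.1 v.base w.base + f.1 u.base (v.base * w.base) - f.1 u.base v.base := by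
          rw [← f.2]; abel
        rw [e]
        abel
      · exact mul_assoc _ _ _)
    (by
      intro u
      ext
      · rw [mul_fib, one_fib, one_base, cocycle_one_left u.base]; abel
      · exact one_mul _)
    (by
      intro u
      ext
      · rw [mul_fib, inv_fib, inv_base, one_fib]; abel
      · exact inv_mul_cancel _)

variable (f) in
/-- The projection of the central extension to the base group. -/
def proj : CocycleExt f →* G where
  toFun := base
  map_one' := rfl
  map_mul' _ _ := rfl

variable (f) in
/-- The inclusion of the kernel in the central extension. -/
def incl : Multiplicative D →* CocycleExt f where
  toFun d := ⟨d.toAdd - f.1 1 1, 1⟩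
  map_one' := by ext <;> simp [one_fib, one_base]
  map_mul' a b := by
    ext
    · simp only [mul_fib, toAdd_mul]; abel
    · simp [mul_base]

theorem incl_commute (d : Multiplicative D) (u : CocycleExt f) : Commute (incl f d) u := by
  ext
  · simp only [mul_fib, incl, MonoidHom.coe_mk, OneHom.coe_mk, cocycle_one_left,
      cocycle_one_right]
    abel
  · simp [mul_base, incl]

theorem eq_incl_of_proj_eq_one {u : CocycleExt f} (hu : proj f u = 1) :
    ∃ d, u = incl f d := by
  refine ⟨Multiplicative.ofAdd (u.fib + f.1 1 1), ?_⟩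
  ext
  · simp [incl]
  · exact hu

theorem commute_iff {u v : CocycleExt f} (hc : Commute (proj f u) (proj f v)) :
    Commute u v ↔ commPairing _ _ hc (H2mk f) = 0 := by
  rw [commPairing_mk, sub_eq_zero]
  constructor
  · intro h
    have := congrArg fib h.eq
    rw [mul_fib, mul_fib, add_comm v.fib] at this
    exact add_left_cancel this
  · intro h
    ext
    · rw [mul_fib, mul_fib, add_comm v.fib]
      exact congrArg _ h
    · exact hc.eq

/-- If `D` is `m`-divisible, elements of exponent `m` lift to elements of exponent `m`. -/
theorem exists_lift_pow_eq_one {m : ℕ} (hD : ∀ d : D, ∃ e : D, m • e = d) {t : G}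
    (ht : t ^ m = 1) : ∃ u : CocycleExt f, proj f u = t ∧ u ^ m = 1 := by
  obtain ⟨d, hd⟩ := eq_incl_of_proj_eq_one (f := f) (u := (⟨0, t⟩ : CocycleExt f) ^ m)
    (by rw [map_pow]; exact ht)
  obtain ⟨e, he⟩ := hD (-d.toAdd)
  refine ⟨incl f (Multiplicative.ofAdd e) * ⟨0, t⟩, ?_, ?_⟩
  · rw [map_mul]
    exact one_mul t
  · rw [(incl_commute _ _).mul_pow, hd, ← map_pow, ← ofAdd_nsmul, he, ← map_mul]
    simp

/-- A cocycle whose central extension splits is a coboundary. -/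
theorem mk_eq_zero_of_section (s : G →* CocycleExt f) (hs : ∀ g, proj f (s g) = g) :
    H2mk f = 0 := by
  refine (QuotientAddGroup.eq_zero_iff f).mpr (AddSubgroup.mem_addSubgroupOf.mpr ?_)
  refine ⟨fun g => -(s g).fib, fun g h => ?_⟩
  have hb : ∀ g, (s g).base = g := hs
  simp only [map_mul, mul_fib, hb]
  abel

end CocycleExt

/-! ### The Heisenberg group -/

theorem pow_zmod_val_add {M : Type} [Monoid M] {m : ℕ} [NeZero m] {g : M} (hg : g ^ m = 1)
    (a b : ZMod m) : g ^ (a + b).val = g ^ a.val * g ^ b.val := by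
  rw [ZMod.val_add, ← pow_add, ← pow_eq_pow_mod _ hg]

theorem pow_zmod_val_mul {M : Type} [Monoid M] {m : ℕ} {g : M} (hg : g ^ m = 1)
    (a b : ZMod m) : g ^ (a * b).val = g ^ (a.val * b.val) := by
  rw [ZMod.val_mul, ← pow_eq_pow_mod _ hg]

/-- The homomorphism from `ℤ/m` determined by an element of exponent `m`. -/
def zmodPowHom {M : Type} [Monoid M] {m : ℕ} [NeZero m] (g : M) (hg : g ^ m = 1) :
    Multiplicative (ZMod m) →* M where
  toFun a := g ^ a.toAdd.val
  map_one' := by simp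
  map_mul' a b := pow_zmod_val_add hg a.toAdd b.toAdd

/-- The Heisenberg group over a commutative ring. -/
@[ext]
structure Heis (R : Type) where
  /-- The exponent of the first generator. -/
  a : R
  /-- The exponent of the second generator. -/
  b : R
  /-- The exponent of the central generator. -/
  c : R

namespace Heis

variable {R : Type} [CommRing R]

instance : Mul (Heis R) := ⟨fun u v => ⟨u.a + v.a, u.b + v.b, u.c + v.c + u.a * v.b⟩⟩

instance : One (Heis R) := ⟨⟨0, 0, 0⟩⟩

instance : Inv (Heis R) := ⟨fun u => ⟨-u.a, -u.b, -u.c + u.a * u.b⟩⟩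

@[simp] theorem mul_a (u v : Heis R) : (u * v).a = u.a + v.a := rfl

@[simp] theorem mul_b (u v : Heis R) : (u * v).b = u.b + v.b := rfl

@[simp] theorem mul_c (u v : Heis R) : (u * v).c = u.c + v.c + u.a * v.b := rfl

@[simp] theorem one_a : (1 : Heis R).a = 0 := rfl

@[simp] theorem one_b : (1 : Heis R).b = 0 := rfl

@[simp] theorem one_c : (1 : Heis R).c = 0 := rfl

@[simp] theorem inv_a (u : Heis R) : (u⁻¹).a = -u.a := rfl

@[simp] theorem inv_b (u : Heis R) : (u⁻¹).b = -u.b := rfl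

@[simp] theorem inv_c (u : Heis R) : (u⁻¹).c = -u.c + u.a * u.b := rfl

instance : Group (Heis R) :=
  Group.ofLeftAxioms
    (by intro u v w; ext <;> simp only [mul_a, mul_b, mul_c] <;> ring)
    (by intro u; ext <;> simp)
    (by intro u; ext <;> simp)

/-- The first generator. -/
def x : Heis R := ⟨1, 0, 0⟩

/-- The second generator. -/
def y : Heis R := ⟨0, 1, 0⟩

/-- The central generator. -/
def z : Heis R := ⟨0, 0, 1⟩

theorem x_pow (m : ℕ) : (x : Heis R) ^ m = ⟨m, 0, 0⟩ := by
  induction m with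
  | zero => ext <;> simp
  | succ m ih => rw [pow_succ, ih]; ext <;> simp [x]

theorem y_pow (m : ℕ) : (y : Heis R) ^ m = ⟨0, m, 0⟩ := by
  induction m with
  | zero => ext <;> simp
  | succ m ih => rw [pow_succ, ih]; ext <;> simp [y]

theorem z_pow (m : ℕ) : (z : Heis R) ^ m = ⟨0, 0, m⟩ := by
  induction m with
  | zero => ext <;> simp
  | succ m ih => rw [pow_succ, ih]; ext <;> simp [z]

theorem x_mul_y : (x : Heis R) * y = y * x * z := by ext <;> simp [x, y, z]

theorem commute_z (u : Heis R) : Commute z u := by ext <;> simp [z, add_comm]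

theorem pow_mul_pow {M : Type} [Monoid M] {x y z : M} (hxy : x * y = y * x * z)
    (hxz : Commute z x) (hyz : Commute z y) (m k : ℕ) :
    x ^ m * y ^ k = y ^ k * x ^ m * z ^ (m * k) := by
  have h1 : ∀ k : ℕ, x * y ^ k = y ^ k * x * z ^ k := by
    intro k
    induction k with
    | zero => simp
    | succ k ih =>
      calc x * y ^ (k + 1) = y ^ k * x * (z ^ k * y) := by
            rw [pow_succ, ← mul_assoc, ih, mul_assoc]
        _ = y ^ k * (x * y) * z ^ k := by rw [(hyz.pow_left k).eq]; simp only [mul_assoc]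
        _ = y ^ (k + 1) * x * z ^ (k + 1) := by
            rw [hxy, pow_succ, pow_succ']; simp only [mul_assoc]
  induction m with
  | zero => simp
  | succ m ih =>
    calc x ^ (m + 1) * y ^ k = x ^ m * (x * y ^ k) := by rw [pow_succ, mul_assoc]
      _ = x ^ m * y ^ k * (x * z ^ k) := by rw [h1]; simp only [mul_assoc]
      _ = y ^ k * x ^ m * (z ^ (m * k) * x) * z ^ k := by rw [ih]; simp only [mul_assoc]
      _ = y ^ k * x ^ (m + 1) * z ^ ((m + 1) * k) := by
          rw [(hxz.pow_left (m * k)).eq, pow_succ, add_mul, one_mul, pow_add]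
          simp only [mul_assoc]

/-- The homomorphism from the Heisenberg group over `ℤ/m` determined by a triple of elements
satisfying its defining relations. -/
def lift {M : Type} [Monoid M] {m : ℕ} [NeZero m] {x y z : M} (hx : x ^ m = 1)
    (hy : y ^ m = 1) (hz : z ^ m = 1) (hxy : x * y = y * x * z)
    (hxz : Commute z x) (hyz : Commute z y) : Heis (ZMod m) →* M where
  toFun u := y ^ u.b.val * x ^ u.a.val * z ^ u.c.val
  map_one' := by simp
  map_mul' u v := by
    simp only [mul_a, mul_b, mul_c, pow_zmod_val_add hx, pow_zmod_val_add hy,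
      pow_zmod_val_add hz, pow_zmod_val_mul hz]
    have h1 := pow_mul_pow hxy hxz hyz u.a.val v.b.val
    have h2 : ∀ i j k : ℕ, z ^ i * (y ^ j * x ^ k) = y ^ j * x ^ k * z ^ i := fun i j k =>
      (((hyz.pow_pow i j).mul_right (hxz.pow_pow i k))).eq
    symm
    calc y ^ u.b.val * x ^ u.a.val * z ^ u.c.val * (y ^ v.b.val * x ^ v.a.val * z ^ v.c.val)
        = y ^ u.b.val * x ^ u.a.val * (z ^ u.c.val * (y ^ v.b.val * x ^ v.a.val))
            * z ^ v.c.val := by simp only [mul_assoc]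
      _ = y ^ u.b.val * (x ^ u.a.val * y ^ v.b.val) * x ^ v.a.val
            * (z ^ u.c.val * z ^ v.c.val) := by rw [h2]; simp only [mul_assoc]
      _ = y ^ u.b.val * y ^ v.b.val * x ^ u.a.val
            * (z ^ (u.a.val * v.b.val) * x ^ v.a.val) * (z ^ u.c.val * z ^ v.c.val) := by
          rw [h1]; simp only [mul_assoc]
      _ = y ^ u.b.val * y ^ v.b.val * (x ^ u.a.val * x ^ v.a.val)
            * (z ^ (u.a.val * v.b.val) * (z ^ u.c.val * z ^ v.c.val)) := by
          rw [(hxz.pow_pow _ _).eq]; simp only [mul_assoc]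
      _ = _ := by
          congr 1
          simp only [← pow_add]
          congr 1
          ring

theorem lift_apply {M : Type} [Monoid M] {m : ℕ} [NeZero m] {x y z : M} (hx : x ^ m = 1)
    (hy : y ^ m = 1) (hz : z ^ m = 1) (hxy : x * y = y * x * z)
    (hxz : Commute z x) (hyz : Commute z y) (u : Heis (ZMod m)) :
    lift hx hy hz hxy hxz hyz u = y ^ u.b.val * x ^ u.a.val * z ^ u.c.val := rfl

theorem eq_prod_pow {m : ℕ} [NeZero m] (u : Heis (ZMod m)) :
    y ^ u.b.val * x ^ u.a.val * z ^ u.c.val = u := by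
  rw [x_pow, y_pow, z_pow]
  ext <;> simp

/-- The Heisenberg group is the product of its three coordinates. -/
def equivProd (R : Type) : Heis R ≃ R × R × R where
  toFun u := (u.a, u.b, u.c)
  invFun t := ⟨t.1, t.2.1, t.2.2⟩
  left_inv _ := rfl
  right_inv _ := rfl

theorem card_zmod (m : ℕ) : Nat.card (Heis (ZMod m)) = m ^ 3 := by
  rw [Nat.card_congr (equivProd _), Nat.card_prod, Nat.card_prod, Nat.card_zmod]
  ring

end Heis

/-! ### Recognising the groups -/

open scoped commutatorElement in
theorem nonempty_heis_mulEquiv {p : ℕ} [Fact p.Prime] {H : Type} [Group H] [Finite H]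
    (hcard : Nat.card H = p ^ 3) (hcen : Subgroup.center H = commutator H)
    (hcencard : Nat.card (Subgroup.center H) = p) (hexp : ∀ x : H, x ^ p = 1) :
    Nonempty (Heis (ZMod p) ≃* H) := by
  have hp : p.Prime := Fact.out
  obtain ⟨x, y, hxy⟩ : ∃ x y : H, x * y ≠ y * x := by
    by_contra! hcomm
    have htop : Subgroup.center H = ⊤ :=
      eq_top_iff.mpr fun g _ => Subgroup.mem_center_iff.mpr fun k => hcomm k g
    rw [htop, Subgroup.card_top, hcard] at hcencard
    have := Nat.pow_right_injective hp.two_le (hcencard.trans (pow_one p).symm)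
    omega
  let z : H := (y * x)⁻¹ * (x * y)
  have hz : z ∈ Subgroup.center H := by
    rw [hcen]
    have : z = ⁅x⁻¹, y⁻¹⁆ := by simp [z, commutatorElement_def, mul_assoc]
    rw [this]
    exact Subgroup.commutator_mem_commutator (Subgroup.mem_top _) (Subgroup.mem_top _)
  have hzc : ∀ g, Commute z g := fun g => (Subgroup.mem_center_iff.mp hz g).symm
  have hz1 : z ≠ 1 := fun h => hxy (by rw [inv_mul_eq_one] at h; exact h.symm)
  have hord : orderOf z = p := orderOf_eq_prime (hexp z) hz1
  let φ : Heis (ZMod p) →* H := Heis.lift (hexp x) (hexp y) (hexp z)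
    (mul_inv_cancel_left _ _).symm (hzc x) (hzc y)
  have hcenter : ∀ c : ZMod p, φ ⟨0, 0, c⟩ = 1 → c = 0 := by
    intro c hc
    have hc' : z ^ c.val = 1 := by simpa [φ, Heis.lift_apply] using hc
    rw [← ZMod.val_eq_zero]
    have hdvd := orderOf_dvd_of_pow_eq_one hc'
    rw [hord] at hdvd
    exact Nat.eq_zero_of_dvd_of_lt hdvd (ZMod.val_lt c)
  have hinj : Function.Injective φ := by
    refine (injective_iff_map_eq_one φ).mpr fun u hu => ?_
    have hb : u.b = 0 := by
      apply hcenter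
      have e : (⟨0, 0, u.b⟩ : Heis (ZMod p)) = Heis.x * u * Heis.x⁻¹ * u⁻¹ := by
        ext <;> simp [Heis.x]
        ring
      rw [e]
      simp [hu]
    have ha : u.a = 0 := by
      apply hcenter
      have e : (⟨0, 0, u.a⟩ : Heis (ZMod p)) = u * Heis.y * u⁻¹ * Heis.y⁻¹ := by
        ext <;> simp [Heis.y]
        ring
      rw [e]
      simp [hu]
    have hu' : u = ⟨0, 0, u.c⟩ := by ext <;> simp [ha, hb]
    have hc : u.c = 0 := hcenter _ (hu' ▸ hu)
    rw [hu', hc]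
    rfl
  exact ⟨MulEquiv.ofBijective φ (hinj.bijective_of_nat_card_le
    (by rw [hcard, Heis.card_zmod]))⟩

theorem nonempty_addEquiv_fun {p n : ℕ} [Fact p.Prime] {V : Type} [AddCommGroup V]
    [Module (ZMod p) V] [Finite V] (hcard : Nat.card V = p ^ n) :
    Nonempty (V ≃+ (Fin n → ZMod p)) := by
  have hp : p.Prime := Fact.out
  have hrank : Module.finrank (ZMod p) V = n :=
    Nat.pow_right_injective hp.two_le
      ((FiniteField.pow_finrank_eq_natCard p V).trans hcard)
  exact ⟨(Module.finBasisOfFinrankEq (ZMod p) V hrank).equivFun.toAddEquiv⟩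

theorem nonempty_elementaryAbelian_mulEquiv {p n : ℕ} [Fact p.Prime] {C : Type} [Group C]
    [Finite C] (hcomm : ∀ x y : C, x * y = y * x) (hexp : ∀ x : C, x ^ p = 1)
    (hcard : Nat.card C = p ^ n) :
    Nonempty (C ≃* (Fin n → Multiplicative (ZMod p))) := by
  let _ : AddCommGroup (Additive C) :=
    { (inferInstance : AddGroup (Additive C)) with
      add_comm := fun c d => congrArg Additive.ofMul (hcomm c.toMul d.toMul) }
  let _ : Module (ZMod p) (Additive C) :=
    AddCommGroup.zmodModule fun c => congrArg Additive.ofMul (hexp c.toMul)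
  obtain ⟨e⟩ := nonempty_addEquiv_fun (p := p) (V := Additive C) hcard
  refine ⟨MulEquiv.mk ⟨fun c i => Multiplicative.ofAdd (e (Additive.ofMul c) i),
    fun v => (e.symm fun i => (v i).toAdd).toMul, fun c => ?_, fun v => ?_⟩ fun c d => ?_⟩
  · simp
  · funext i
    simp
  · exact congrArg (fun w i => Multiplicative.ofAdd (w i))
      (e.map_add (Additive.ofMul c) (Additive.ofMul d))

theorem nonempty_H2_addEquiv {G G' : Type} [Group G] [Group G'] (D : Type) [AddCommGroup D]
    (e : G ≃* G') : Nonempty (H2 G D ≃+ H2 G' D) := by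
  refine ⟨AddMonoidHom.toAddEquiv (H2Map e.symm.toMonoidHom) (H2Map e.toMonoidHom) ?_ ?_⟩
  · ext x
    obtain ⟨f, rfl⟩ := QuotientAddGroup.mk_surjective x
    refine congrArg QuotientAddGroup.mk (Subtype.ext ?_)
    funext g h
    simp [pullCocycle]
  · ext x
    obtain ⟨f, rfl⟩ := QuotientAddGroup.mk_surjective x
    refine congrArg QuotientAddGroup.mk (Subtype.ext ?_)
    funext g h
    simp [pullCocycle]

/-! ### The model group and its pairs of commuting generators -/

/-- The product of the Heisenberg group over `ℤ/p` and an elementary abelian group. -/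
abbrev HeisProd (p n : ℕ) : Type := Heis (ZMod p) × (Fin n → Multiplicative (ZMod p))

/-- The `i`-th generator of the elementary abelian factor. -/
def elemGen {p n : ℕ} (i : Fin n) : Fin n → Multiplicative (ZMod p) :=
  Pi.mulSingle i (Multiplicative.ofAdd 1)

theorem toAdd_elemGen {p n : ℕ} (i j : Fin n) :
    (elemGen (p := p) i j).toAdd = if j = i then 1 else 0 := by
  rw [elemGen, Pi.mulSingle_apply]
  split_ifs <;> rfl

theorem elemGen_pow {p n : ℕ} (i : Fin n) : elemGen (p := p) i ^ p = 1 := by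
  rw [elemGen, ← Pi.mulSingle_pow, ← ofAdd_nsmul]
  simp

/-- The index set for the invariants of a class in `H²(HeisProd p n, D)`. -/
abbrev PairIndex (n : ℕ) : Type :=
  Bool ⊕ (Bool × Fin n) ⊕ {q : Fin n × Fin n // q.2 < q.1}

theorem card_pairIndex (n : ℕ) : Nat.card (PairIndex n) = n * (n + 3) / 2 + 2 := by
  have h : Fintype.card {q : Fin n × Fin n // q.2 < q.1} = ∑ i ∈ Finset.range n, i := by
    rw [Fintype.card_congr (Equiv.subtypeProdEquivSigmaSubtype fun a b : Fin n => b < a),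
      Fintype.card_sigma, ← Fin.sum_univ_eq_sum_range]
    refine Finset.sum_congr rfl fun i _ => ?_
    rw [Fintype.card_subtype, Finset.filter_gt_eq_Iio, Fin.card_Iio]
  rw [Nat.card_eq_fintype_card]
  simp only [Fintype.card_sum, Fintype.card_prod, Fintype.card_bool, Fintype.card_fin, h]
  have h2 := Finset.sum_range_id_mul_two n
  have h3 : n * (n + 3) = n * (n - 1) + 4 * n := by
    cases n with
    | zero => rfl
    | succ m => simp only [Nat.add_sub_cancel]; ring
  omega

/-- The pairs of commuting generators of `HeisProd p n`. -/
def genPair (p : ℕ) {n : ℕ} : PairIndex n → HeisProd p n × HeisProd p n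
  | .inl true => ((Heis.x, 1), (Heis.z, 1))
  | .inl false => ((Heis.z, 1), (Heis.y, 1))
  | .inr (.inl (true, i)) => ((Heis.x, 1), (1, elemGen i))
  | .inr (.inl (false, i)) => ((Heis.y, 1), (1, elemGen i))
  | .inr (.inr q) => ((1, elemGen q.1.1), (1, elemGen q.1.2))

theorem commute_genPair (p : ℕ) {n : ℕ} (k : PairIndex n) :
    Commute (genPair p k).1 (genPair p k).2 := by
  rcases k with (_ | _) | ⟨_ | _, i⟩ | q
  · exact Commute.prod (Heis.commute_z _) (Commute.one_left _)
  · exact Commute.prod (Heis.commute_z _).symm (Commute.one_left _)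
  · exact Commute.prod (Commute.one_right _) (Commute.one_left _)
  · exact Commute.prod (Commute.one_right _) (Commute.one_left _)
  · exact Commute.prod (Commute.one_right _) (Commute.all _ _)

theorem genPair_snd_pow (p : ℕ) {n : ℕ} (k : PairIndex n) : (genPair p k).2 ^ p = 1 := by
  rcases k with (_ | _) | ⟨_ | _, i⟩ | q
  · exact Prod.ext ((Heis.y_pow p).trans (by ext <;> simp)) (one_pow p)
  · exact Prod.ext ((Heis.z_pow p).trans (by ext <;> simp)) (one_pow p)
  all_goals exact Prod.ext (one_pow p) (elemGen_pow _)

/-- The commutator pairing on the `k`-th pair of commuting generators. -/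
def genPairing (p : ℕ) {n : ℕ} (D : Type) [AddCommGroup D] (k : PairIndex n) :
    H2 (HeisProd p n) D →+ D :=
  commPairing _ _ (commute_genPair p k)

/-! ### Classes are determined by their commutator pairings -/

theorem CocycleExt.commute_of_commPairing_eq_zero {G : Type} [Group G] {D : Type}
    [AddCommGroup D] {f : cocycles2 G D} {u v : CocycleExt f} {g h : G}
    (hu : proj f u = g) (hv : proj f v = h) (hc : Commute g h)
    (h0 : commPairing g h hc (H2mk f) = 0) : Commute u v := by
  subst hu hv
  exact (commute_iff hc).mpr h0

open CocycleExt in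
theorem mk_eq_zero_of_genPairing_eq_zero {p n : ℕ} [NeZero p] {D : Type} [AddCommGroup D]
    (hD : ∀ d : D, ∃ e : D, p • e = d) (f : cocycles2 (HeisProd p n) D)
    (hf : ∀ k, genPairing p D k (H2mk f) = 0) : H2mk f = 0 := by
  obtain ⟨x, hx, hxp⟩ := exists_lift_pow_eq_one (f := f) hD (t := (Heis.x, 1))
    (Prod.ext ((Heis.x_pow p).trans (by ext <;> simp)) (one_pow p))
  obtain ⟨y, hy, hyp⟩ := exists_lift_pow_eq_one (f := f) hD (t := (Heis.y, 1))
    (Prod.ext ((Heis.y_pow p).trans (by ext <;> simp)) (one_pow p))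
  have hlift : ∀ i : Fin n, ∃ u : CocycleExt f, proj f u = (1, elemGen i) ∧ u ^ p = 1 :=
    fun i => exists_lift_pow_eq_one hD (Prod.ext (one_pow p) (elemGen_pow i))
  choose c hc hcp using hlift
  obtain ⟨z, hxy⟩ : ∃ z, x * y = y * x * z := ⟨(y * x)⁻¹ * (x * y), (mul_inv_cancel_left _ _).symm⟩
  have hz : proj f z = (Heis.z, 1) := by
    have h := congrArg (proj f) hxy
    simp only [map_mul, hx, hy] at h
    refine mul_left_cancel (h.symm.trans (Prod.ext Heis.x_mul_y ?_))
    simp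
  have hzx : Commute z x :=
    (commute_of_commPairing_eq_zero hx hz _ (hf (.inl true))).symm
  have hzy : Commute z y := commute_of_commPairing_eq_zero hz hy _ (hf (.inl false))
  have hzp : z ^ p = 1 := by
    simpa [hxp] using Heis.pow_mul_pow hxy hzx hzy p 1
  have hxc : ∀ i, Commute x (c i) := fun i =>
    commute_of_commPairing_eq_zero hx (hc i) _ (hf (.inr (.inl (true, i))))
  have hyc : ∀ i, Commute y (c i) := fun i =>
    commute_of_commPairing_eq_zero hy (hc i) _ (hf (.inr (.inl (false, i))))
  have hzc : ∀ i, Commute z (c i) := fun i => by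
    have e : z = (y * x)⁻¹ * (x * y) := by rw [hxy, inv_mul_cancel_left]
    rw [e]
    exact ((hyc i).mul_left (hxc i)).inv_left.mul_left ((hxc i).mul_left (hyc i))
  have hcc' : ∀ i j, i < j → Commute (c j) (c i) := fun i j hij =>
    commute_of_commPairing_eq_zero (hc j) (hc i) _ (hf (.inr (.inr ⟨(j, i), hij⟩)))
  have hcc : ∀ i j, i ≠ j → Commute (c i) (c j) := fun i j hij =>
    hij.lt_or_gt.elim (fun h => (hcc' i j h).symm) (fun h => hcc' j i h)
  let s₁ : Heis (ZMod p) →* CocycleExt f := Heis.lift hxp hyp hzp hxy hzx hzy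
  have hs₁ : ∀ u, proj f (s₁ u) = (u, 1) := fun u => by
    simp only [s₁, Heis.lift_apply, map_mul, map_pow, hx, hy, hz]
    exact Prod.ext (Heis.eq_prod_pow u) (by simp)
  let s₂ : (Fin n → Multiplicative (ZMod p)) →* CocycleExt f :=
    MonoidHom.noncommPiCoprod (fun i => zmodPowHom (c i) (hcp i))
      (fun i j hij a b => (hcc i j hij).pow_pow _ _)
  have hs₂' : ∀ i a, s₂ (Pi.mulSingle i a) = c i ^ a.toAdd.val := fun i a =>
    MonoidHom.noncommPiCoprod_mulSingle (N := fun _ => Multiplicative (ZMod p)) _ i a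
  have hs₂ : ∀ v, proj f (s₂ v) = (1, v) := by
    refine DFunLike.congr_fun (f := (proj f).comp s₂)
      (g := MonoidHom.inr (Heis (ZMod p)) (Fin n → Multiplicative (ZMod p))) ?_
    refine MonoidHom.pi_ext fun i a => ?_
    rw [MonoidHom.comp_apply, hs₂', MonoidHom.inr_apply, map_pow, hc]
    refine Prod.ext (one_pow _) ?_
    change elemGen (p := p) i ^ a.toAdd.val = _
    rw [elemGen, ← Pi.mulSingle_pow, ← ofAdd_nsmul]
    simp
  have hcomm : ∀ u v, Commute (s₁ u) (s₂ v) := by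
    intro u v
    refine Pi.mulSingle_induction (M := fun _ => Multiplicative (ZMod p))
      (fun v => Commute (s₁ u) (s₂ v)) v ?_ ?_ ?_
    · simp
    · intro v w hv hw
      rw [map_mul]
      exact hv.mul_right hw
    · intro i a
      rw [hs₂']
      exact ((((hyc i).pow_pow _ _).mul_left ((hxc i).pow_pow _ _)).mul_left
        ((hzc i).pow_pow _ _))
  refine mk_eq_zero_of_section (s₁.noncommCoprod s₂ hcomm) fun g => ?_
  rw [MonoidHom.noncommCoprod_apply, map_mul, hs₁, hs₂]
  simp

/-! ### Classes with prescribed commutator pairings -/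

/-- Pushforward of a cocycle along a homomorphism of coefficients. -/
def pushCocycle {G : Type} [Group G] {A D : Type} [AddCommGroup A] [AddCommGroup D]
    (ι : A →+ D) (f : cocycles2 G A) : cocycles2 G D :=
  ⟨fun g h => ι (f.1 g h), fun g h k => by rw [← map_add, f.2, map_add]⟩

/-- The product of two homomorphisms to the additive group of a ring is a cocycle. -/
def mulCocycle {G : Type} [Group G] {R : Type} [CommRing R]
    (φ ψ : G →* Multiplicative R) : cocycles2 G R :=
  ⟨fun g h => (φ g).toAdd * (ψ h).toAdd, fun g h k => by
    simp only [map_mul, toAdd_mul]; ring⟩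

namespace Heis

variable (R : Type) [CommRing R]

/-- The first coordinate. -/
def aHom : Heis R →* Multiplicative R where
  toFun u := Multiplicative.ofAdd u.a
  map_one' := rfl
  map_mul' _ _ := rfl

/-- The second coordinate. -/
def bHom : Heis R →* Multiplicative R where
  toFun u := Multiplicative.ofAdd u.b
  map_one' := rfl
  map_mul' _ _ := rfl

variable {R}

/-- A cocycle on the Heisenberg group pairing `x` and `z`. -/
def xzCocycle (r : R) (hr : 2 * r = 1) : cocycles2 (Heis R) R :=
  ⟨fun u v => u.a * v.c + r * u.a ^ 2 * v.b, fun u v w => by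
    simp only [mul_a, mul_b, mul_c]
    linear_combination (u.a * v.a * w.b) * hr⟩

/-- A cocycle on the Heisenberg group pairing `z` and `y`. -/
def zyCocycle (r : R) (hr : 2 * r = 1) : cocycles2 (Heis R) R :=
  ⟨fun u v => u.c * v.b + r * u.a * v.b ^ 2, fun u v w => by
    simp only [mul_a, mul_b, mul_c]
    linear_combination (-(u.a * v.b * w.b)) * hr⟩

end Heis

/-- The `i`-th coordinate of the elementary abelian factor. -/
def elemCoord (p : ℕ) {n : ℕ} (i : Fin n) : HeisProd p n →* Multiplicative (ZMod p) :=
  (Pi.evalMonoidHom _ i).comp (MonoidHom.snd _ _)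

/-- The cocycles dual to the pairs of commuting generators of `HeisProd p n`. -/
def genCocycle {p n : ℕ} (r : ZMod p) (hr : 2 * r = 1) :
    PairIndex n → cocycles2 (HeisProd p n) (ZMod p)
  | .inl true => pullCocycle (MonoidHom.fst _ _) (Heis.xzCocycle r hr)
  | .inl false => pullCocycle (MonoidHom.fst _ _) (Heis.zyCocycle r hr)
  | .inr (.inl (true, i)) =>
      mulCocycle ((Heis.aHom _).comp (MonoidHom.fst _ _)) (elemCoord p i)
  | .inr (.inl (false, i)) =>
      mulCocycle ((Heis.bHom _).comp (MonoidHom.fst _ _)) (elemCoord p i)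
  | .inr (.inr q) => mulCocycle (elemCoord p q.1.1) (elemCoord p q.1.2)

theorem genCocycle_genPair {p n : ℕ} (r : ZMod p) (hr : 2 * r = 1) (k l : PairIndex n) :
    (genCocycle r hr k).1 (genPair p l).1 (genPair p l).2
      - (genCocycle r hr k).1 (genPair p l).2 (genPair p l).1 = if k = l then 1 else 0 := by
  rcases k with (_ | _) | ⟨_ | _, i⟩ | ⟨⟨j, i⟩, hij⟩ <;>
  rcases l with (_ | _) | ⟨_ | _, i'⟩ | ⟨⟨j', i'⟩, hij'⟩ <;>
  simp [genCocycle, genPair, pullCocycle, mulCocycle, Heis.xzCocycle, Heis.zyCocycle,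
    Heis.x, Heis.y, Heis.z, elemCoord, Heis.aHom, Heis.bHom, toAdd_elemGen]
  grind

theorem genPairing_push_genCocycle {p n : ℕ} {D : Type} [AddCommGroup D] (ι : ZMod p →+ D)
    (r : ZMod p) (hr : 2 * r = 1) (k l : PairIndex n) :
    genPairing p D l (H2mk (pushCocycle ι (genCocycle r hr k))) = ι (if k = l then 1 else 0) := by
  rw [← genCocycle_genPair r hr k l, map_sub]
  rfl

theorem exists_genPairing_eq {p n : ℕ} (hodd : Odd p) {D : Type} [AddCommGroup D]
    (ι : ZMod p →+ D) (w : PairIndex n → ZMod p) :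
    ∃ x : H2 (HeisProd p n) D, ∀ l, genPairing p D l x = ι (w l) := by
  obtain ⟨m, hm⟩ := hodd
  have hr : 2 * (-m : ZMod p) = 1 := by
    have : ((2 * m + 1 : ℕ) : ZMod p) = 0 := by rw [← hm]; simp
    push_cast at this
    linear_combination -this
  refine ⟨∑ k, H2mk (pushCocycle (ι.comp (AddMonoidHom.mulLeft (w k)))
    (genCocycle (-m : ZMod p) hr k)), fun l => ?_⟩
  rw [map_sum]
  simp only [genPairing_push_genCocycle]
  simp [← map_sum]

/-! ### The Schur multiplier of the model group -/

theorem injective_genPairing {p n : ℕ} [NeZero p] {D : Type} [AddCommGroup D]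
    (hD : ∀ d : D, ∃ e : D, p • e = d) :
    Function.Injective fun (x : H2 (HeisProd p n) D) k => genPairing p D k x := by
  intro x y hxy
  rw [← sub_eq_zero]
  obtain ⟨f, hf⟩ := QuotientAddGroup.mk_surjective (x - y)
  have h0 : H2mk f = 0 := mk_eq_zero_of_genPairing_eq_zero hD f fun k => by
    change genPairing p D k (QuotientAddGroup.mk f) = 0
    rw [hf, map_sub, sub_eq_zero]
    exact congrFun hxy k
  exact hf.symm.trans h0

theorem nsmul_H2_heisProd {p n : ℕ} [NeZero p] {D : Type} [AddCommGroup D]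
    (hD : ∀ d : D, ∃ e : D, p • e = d) (x : H2 (HeisProd p n) D) : p • x = 0 := by
  apply injective_genPairing hD
  funext k
  simp only [map_nsmul, map_zero]
  exact nsmul_commPairing _ (genPair_snd_pow p k) x

theorem card_H2_heisProd {p n : ℕ} [NeZero p] (hodd : Odd p) {D : Type} [AddCommGroup D]
    (hD : ∀ d : D, ∃ e : D, p • e = d) (ι : ZMod p →+ D) (hι : Function.Injective ι)
    (hιD : ∀ d : D, p • d = 0 → ∃ a, ι a = d) :
    Nat.card (H2 (HeisProd p n) D) = p ^ (n * (n + 3) / 2 + 2) := by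
  choose F hF using exists_genPairing_eq (n := n) hodd ι
  have hbij : Function.Bijective F := by
    refine ⟨fun v w hvw => funext fun l => hι ?_, fun x => ?_⟩
    · rw [← hF, ← hF, hvw]
    · choose w hw using fun k => hιD (genPairing p D k x)
        (nsmul_commPairing _ (genPair_snd_pow p k) x)
      exact ⟨w, injective_genPairing hD (funext fun k => (hF w k).trans (hw k))⟩
  rw [← Nat.card_congr (Equiv.ofBijective F hbij), Nat.card_fun, Nat.card_zmod, card_pairIndex]

theorem exists_nsmul_eq_units_complex {p : ℕ} (hp : p ≠ 0) (d : Additive ℂˣ) :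
    ∃ e : Additive ℂˣ, p • e = d := by
  obtain ⟨t, ht⟩ := IsAlgClosed.exists_pow_nat_eq (d.toMul : ℂ) (Nat.pos_of_ne_zero hp)
  have ht0 : t ≠ 0 := by
    rintro rfl
    rw [zero_pow hp] at ht
    exact d.toMul.ne_zero ht.symm
  refine ⟨Additive.ofMul (Units.mk0 t ht0), ?_⟩
  rw [← ofMul_pow]
  exact congrArg Additive.ofMul (Units.ext ht)

theorem exists_zmod_hom_units_complex (p : ℕ) [NeZero p] :
    ∃ ι : ZMod p →+ Additive ℂˣ, Function.Injective ι ∧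
      ∀ d, p • d = 0 → ∃ a, ι a = d := by
  obtain ⟨ζ, hζ⟩ : ∃ ζ : ℂˣ, IsPrimitiveRoot ζ p :=
    ⟨_, (Complex.isPrimitiveRoot_exp p (NeZero.ne p)).isUnit_unit (NeZero.ne p)⟩
  refine ⟨MonoidHom.toAdditiveRight (zmodPowHom ζ hζ.pow_eq_one), fun a b hab => ?_,
    fun d hd => ?_⟩
  · exact ZMod.val_injective p (hζ.pow_inj (ZMod.val_lt a) (ZMod.val_lt b) hab)
  · have hd' : (d.toMul : ℂˣ) ∈ rootsOfUnity p ℂ := hd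
    obtain ⟨i, hi, he⟩ := hζ.eq_pow_of_mem_rootsOfUnity hd'
    refine ⟨(i : ZMod p), ?_⟩
    change Additive.ofMul (ζ ^ (i : ZMod p).val) = d
    rw [ZMod.val_cast_of_lt hi, he]
    rfl

/-- For `p` an odd prime, `H` the extraspecial `p`-group of order `p³` and
exponent `p`, and `C` an elementary abelian `p`-group of rank `n ≥ 1`, the Schur
multiplier `M(H × C) = H²(H × C, ℂ*)` is elementary abelian of order
`p^(n(n+3)/2 + 2)`. -/
theorem schurMultiplier_extraspecial_p3_times_elementaryAbelian (p n : ℕ)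
    (hp : p.Prime) (hodd : Odd p) (hn : 1 ≤ n)
    (H : Type) [Group H] [Finite H]
    (hHcard : Nat.card H = p ^ 3)
    (hHcen : Subgroup.center H = commutator H)
    (hHcencard : Nat.card (Subgroup.center H) = p)
    (hHexp : ∀ x : H, x ^ p = 1)
    (C : Type) [Group C] [Finite C]
    (hCcomm : ∀ x y : C, x * y = y * x)
    (hCexp : ∀ x : C, x ^ p = 1)
    (hCcard : Nat.card C = p ^ n) :
    (∀ x : H2 (H × C) (Additive ℂˣ), p • x = 0) ∧
    Nat.card (H2 (H × C) (Additive ℂˣ)) = p ^ (n * (n + 3) / 2 + 2) := by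
  have : Fact p.Prime := ⟨hp⟩
  obtain ⟨eH⟩ := nonempty_heis_mulEquiv hHcard hHcen hHcencard hHexp
  obtain ⟨eC⟩ := nonempty_elementaryAbelian_mulEquiv hCcomm hCexp hCcard
  obtain ⟨e⟩ := nonempty_H2_addEquiv (Additive ℂˣ) (eH.symm.prodCongr eC)
  have hD := exists_nsmul_eq_units_complex hp.ne_zero
  obtain ⟨ι, hι, hιD⟩ := exists_zmod_hom_units_complex p
  refine ⟨fun x => e.injective ?_, ?_⟩
  · rw [map_nsmul, map_zero]
    exact nsmul_H2_heisProd hD (e x)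
  · rw [Nat.card_congr e.toEquiv]
    exact card_H2_heisProd hodd hD ι hι hιD

end SchurCP
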